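/- Over the 3-periodic billiard family, the incenter X₁† of the focus-inversive triangle lies on the circle with center C₁† = (c(−1 + ρ²(−2a² + b² + 2δ)/(2b⁴)), 0) and radius R₁† = ρ²(−2δ² + b⁴ + (2a² − b²)δ)/(2ab⁴). -/

import Mathlib

noncomputable section

namespace BilliardInv

/-- A point of the plane. -/
abbrev Pt := ℝ × ℝ

/-- Euclidean dot product. -/
def dot (p q : Pt) : ℝ := p.1 * q.1 + p.2 * q.2

/-- Euclidean distance. -/
def dst (p q : Pt) : ℝ := Real.sqrt ((p.1 - q.1) ^ 2 + (p.2 - q.2) ^ 2)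

/-- Membership in the ellipse x²/a² + y²/b² = 1. -/
def onEllipse (a b : ℝ) (p : Pt) : Prop := p.1 ^ 2 / a ^ 2 + p.2 ^ 2 / b ^ 2 = 1

/-- Half the gradient of f(x,y) = x²/a² + y²/b² (an outward normal direction). -/
def nrm (a b : ℝ) (p : Pt) : Pt := (p.1 / a ^ 2, p.2 / b ^ 2)

/-- Unit vector pointing from `v` toward `q`. -/
def udir (v q : Pt) : Pt := (dst v q)⁻¹ • (q - v)

/-- The billiard reflection law at vertex `v` with neighboring vertices `q`, `r`:
the two adjacent sides make equal angles with the ellipse normal at `v`. -/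
def reflectAt (a b : ℝ) (q v r : Pt) : Prop :=
  dot (udir v q) (nrm a b v) = dot (udir v r) (nrm a b v)

/-- A 3-periodic billiard orbit in the ellipse with semi-axes `a > b > 0`:
a nondegenerate triangle inscribed in the ellipse obeying the reflection
law at each vertex. -/
structure Orbit3 (a b : ℝ) : Type where
  P1 : Pt
  P2 : Pt
  P3 : Pt
  h1 : onEllipse a b P1
  h2 : onEllipse a b P2
  h3 : onEllipse a b P3
  d12 : P1 ≠ P2
  d23 : P2 ≠ P3
  d31 : P3 ≠ P1
  r1 : reflectAt a b P3 P1 P2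
  r2 : reflectAt a b P1 P2 P3
  r3 : reflectAt a b P2 P3 P1

/-- Inversion of `p` with respect to the circle of radius `ρ` centered at `f`. -/
def inva (ρ : ℝ) (f p : Pt) : Pt :=
  f + (ρ ^ 2 / ((p.1 - f.1) ^ 2 + (p.2 - f.2) ^ 2)) • (p - f)

/-- Unsigned area of a triangle. -/
def area (A B C : Pt) : ℝ :=
  |(B.1 - A.1) * (C.2 - A.2) - (B.2 - A.2) * (C.1 - A.1)| / 2

/-- The point with barycentric coordinates wA : wB : wC w.r.t. triangle ABC. -/
def bary (wA wB wC : ℝ) (A B C : Pt) : Pt :=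
  (wA + wB + wC)⁻¹ • (wA • A + wB • B + wC • C)

/-- Side length a = |BC|. -/
def sA (A B C : Pt) : ℝ := dst B C
/-- Side length b = |CA|. -/
def sB (A B C : Pt) : ℝ := dst C A
/-- Side length c = |AB|. -/
def sC (A B C : Pt) : ℝ := dst A B

/-- Incenter X(1). -/
def incenter (A B C : Pt) : Pt := bary (sA A B C) (sB A B C) (sC A B C) A B C

/-- Barycenter (centroid) X(2). -/
def centroid (A B C : Pt) : Pt := bary 1 1 1 A B C

/-- Circumcenter X(3), via its barycentric coordinates a²(b²+c²−a²) : · : ·. -/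
def circumcenter (A B C : Pt) : Pt :=
  bary (sA A B C ^ 2 * (sB A B C ^ 2 + sC A B C ^ 2 - sA A B C ^ 2))
       (sB A B C ^ 2 * (sC A B C ^ 2 + sA A B C ^ 2 - sB A B C ^ 2))
       (sC A B C ^ 2 * (sA A B C ^ 2 + sB A B C ^ 2 - sC A B C ^ 2)) A B C

/-- Orthocenter X(4) = A + B + C − 2·(circumcenter). -/
def orthocenter (A B C : Pt) : Pt := A + B + C - (2 : ℝ) • circumcenter A B C

/-- Nine-point center X(5): midpoint of circumcenter and orthocenter. -/
def ninePointCenter (A B C : Pt) : Pt :=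
  ((1 : ℝ) / 2) • (circumcenter A B C + orthocenter A B C)

/-- Gergonne point X(7), barycentrics 1/(b+c−a) : 1/(c+a−b) : 1/(a+b−c). -/
def gergonne (A B C : Pt) : Pt :=
  bary (sB A B C + sC A B C - sA A B C)⁻¹
       (sC A B C + sA A B C - sB A B C)⁻¹
       (sA A B C + sB A B C - sC A B C)⁻¹ A B C

/-- Mittenpunkt X(9), barycentrics a(b+c−a) : b(c+a−b) : c(a+b−c). -/
def mittenpunkt (A B C : Pt) : Pt :=
  bary (sA A B C * (sB A B C + sC A B C - sA A B C))
       (sB A B C * (sC A B C + sA A B C - sB A B C))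
       (sC A B C * (sA A B C + sB A B C - sC A B C)) A B C

/-- Feuerbach point X(11), barycentrics (b+c−a)(b−c)² : · : ·. -/
def feuerbach (A B C : Pt) : Pt :=
  bary ((sB A B C + sC A B C - sA A B C) * (sB A B C - sC A B C) ^ 2)
       ((sC A B C + sA A B C - sB A B C) * (sC A B C - sA A B C) ^ 2)
       ((sA A B C + sB A B C - sC A B C) * (sA A B C - sB A B C) ^ 2) A B C

/-- Triangle center X(100), barycentrics a/(b−c) : b/(c−a) : c/(a−b). -/
def X100 (A B C : Pt) : Pt :=
  bary (sA A B C / (sB A B C - sC A B C))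
       (sB A B C / (sC A B C - sA A B C))
       (sC A B C / (sA A B C - sB A B C)) A B C

/-- Orthogonal projection of `Q` onto the line through `A` and `B`. -/
def projLine (Q A B : Pt) : Pt :=
  A + (dot (Q - A) (B - A) / dot (B - A) (B - A)) • (B - A)

/-- Unsigned area of the pedal triangle of `Q` w.r.t. triangle `A B C`. -/
def pedalArea (Q A B C : Pt) : ℝ :=
  area (projLine Q A B) (projLine Q B C) (projLine Q C A)

end BilliardInv

open BilliardInv Real

lemma fi_cplx (z1 z2 z3 s D : ℂ) (n12 : z1 ≠ z2) (n23 : z2 ≠ z3) (n31 : z3 ≠ z1)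
    (h12 : z1^2+z2^2 - s*(z1^2*z2^2+1) = 2*D*(z1*z2))
    (h23 : z2^2+z3^2 - s*(z2^2*z3^2+1) = 2*D*(z2*z3))
    (h31 : z3^2+z1^2 - s*(z3^2*z1^2+1) = 2*D*(z3*z1)) :
    z1+z2+z3 = -s*(z1*z2*z3) ∧ z1*z2+z2*z3+z3*z1 = -s ∧ 2*D = s^2-1 := by
  have g1 : (z2+z3)*(1-s*z1^2) = 2*D*z1 := by
    apply mul_left_cancel₀ (sub_ne_zero.2 n23)
    linear_combination h12 - h31
  have g2 : (z3+z1)*(1-s*z2^2) = 2*D*z2 := by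
    apply mul_left_cancel₀ (sub_ne_zero.2 n31)
    linear_combination h23 - h12
  have gD : 2*D = -1 - s*(z1*z2+z2*z3+z3*z1) := by
    apply mul_left_cancel₀ (sub_ne_zero.2 n12)
    linear_combination g2 - g1
  have e1 : z1+z2+z3 = -s*(z1*z2*z3) := by
    linear_combination g1 + z1*gD
  have e2 : z1*z2+z2*z3+z3*z1 = -s := by
    linear_combination -h12 - z1*z2*gD + (z1+z2)*e1
  exact ⟨e1, e2, by linear_combination gD - s*e2⟩

lemma fi_pair (X1 Y1 X2 Y2 s D : ℝ) (c1 : X1^2+Y1^2 = 1) (c2 : X2^2+Y2^2 = 1)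
    (h : X1*X2+Y1*Y2 - s*(X1*X2-Y1*Y2) = D) :
    ((X1:ℂ)+Y1*Complex.I)^2+((X2:ℂ)+Y2*Complex.I)^2
      - s*(((X1:ℂ)+Y1*Complex.I)^2*((X2:ℂ)+Y2*Complex.I)^2+1)
      = 2*D*(((X1:ℂ)+Y1*Complex.I)*((X2:ℂ)+Y2*Complex.I)) := by
  have c1' : ((X1:ℂ)+Y1*Complex.I)*((X1:ℂ)-Y1*Complex.I) = 1 := by
    have : (X1:ℂ)^2+(Y1:ℂ)^2 = 1 := by exact_mod_cast c1
    linear_combination this - (Y1:ℂ)^2*Complex.I_sq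
  have c2' : ((X2:ℂ)+Y2*Complex.I)*((X2:ℂ)-Y2*Complex.I) = 1 := by
    have : (X2:ℂ)^2+(Y2:ℂ)^2 = 1 := by exact_mod_cast c2
    linear_combination this - (Y2:ℂ)^2*Complex.I_sq
  have h' : (((X1:ℂ)+Y1*Complex.I)*((X2:ℂ)-Y2*Complex.I)
      + ((X2:ℂ)+Y2*Complex.I)*((X1:ℂ)-Y1*Complex.I))
      - s*(((X1:ℂ)+Y1*Complex.I)*((X2:ℂ)+Y2*Complex.I)
      + ((X1:ℂ)-Y1*Complex.I)*((X2:ℂ)-Y2*Complex.I)) = 2*D := by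
    have : (X1:ℂ)*X2+Y1*Y2 - s*(X1*X2-Y1*Y2) = D := by exact_mod_cast h
    linear_combination 2*this - (2*(Y1:ℂ)*Y2 + 2*s*Y1*Y2)*Complex.I_sq
  generalize (X1:ℂ)+Y1*Complex.I = z1 at *
  generalize (X2:ℂ)+Y2*Complex.I = z2 at *
  generalize (X1:ℂ)-Y1*Complex.I = w1 at *
  generalize (X2:ℂ)-Y2*Complex.I = w2 at *
  linear_combination z1*z2*h' - z1^2*c2' - z2^2*c1' + (s:ℂ)*(z1*w1)*c2' + s*c1'

/-- All the symmetric-function facts about the eccentric-angle coordinates. -/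
lemma fi_sums (X1 Y1 X2 Y2 X3 Y3 s D : ℝ)
    (c1 : X1^2+Y1^2 = 1) (c2 : X2^2+Y2^2 = 1) (c3 : X3^2+Y3^2 = 1)
    (n12 : ¬ (X1 = X2 ∧ Y1 = Y2)) (n23 : ¬ (X2 = X3 ∧ Y2 = Y3)) (n31 : ¬ (X3 = X1 ∧ Y3 = Y1))
    (h12 : X1*X2+Y1*Y2 - s*(X1*X2-Y1*Y2) = D)
    (h23 : X2*X3+Y2*Y3 - s*(X2*X3-Y2*Y3) = D)
    (h31 : X3*X1+Y3*Y1 - s*(X3*X1-Y3*Y1) = D) :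
    ∃ E F : ℝ, E^2+F^2 = 1 ∧ 2*D = s^2-1 ∧
      X1+X2+X3 = -s*E ∧ Y1+Y2+Y3 = -s*F ∧
      X1^2+X2^2+X3^2 = s^2*E^2-(s-3)*(s+1)/2 ∧
      X1*Y1+X2*Y2+X3*Y3 = s^2*E*F ∧
      X1^2*Y1+X2^2*Y2+X3^2*Y3 = (-s^3*(3*E^2*F-F^3)+(3-3*s^2)*F - s*F)/4 ∧
      X1*Y1^2+X2*Y2^2+X3*Y3^2 = (-s*E - (-s^3*(E^3-3*E*F^2)+(3-3*s^2)*E))/4 ∧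
      X1*X2*X3 = E*(1+s)^2/4 ∧
      X1*X2+X2*X3+X3*X1 = (s-3)*(s+1)/4 ∧
      X2*X3-Y2*Y3 = E*X1+F*Y1 ∧ X3*X1-Y3*Y1 = E*X2+F*Y2 ∧ X1*X2-Y1*Y2 = E*X3+F*Y3 := by
  have nz : ∀ X Y X' Y' : ℝ, ¬ (X = X' ∧ Y = Y') →
      (X:ℂ)+Y*Complex.I ≠ (X':ℂ)+Y'*Complex.I := by
    intro X Y X' Y' hn h
    apply hn
    constructor
    · simpa using congrArg Complex.re h
    · simpa using congrArg Complex.im h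
  obtain ⟨e1, e2, hD⟩ := fi_cplx _ _ _ _ _ (nz _ _ _ _ n12) (nz _ _ _ _ n23) (nz _ _ _ _ n31)
    (fi_pair _ _ _ _ s D c1 c2 h12) (fi_pair _ _ _ _ s D c2 c3 h23) (fi_pair _ _ _ _ s D c3 c1 h31)
  have hD' : 2*D = s^2-1 := by exact_mod_cast hD
  obtain ⟨E, hE⟩ : ∃ E, E = X1*X2*X3 - X1*Y2*Y3 - Y1*X2*Y3 - Y1*Y2*X3 := ⟨_, rfl⟩
  obtain ⟨F, hF⟩ : ∃ F, F = X1*X2*Y3 + X1*Y2*X3 + Y1*X2*X3 - Y1*Y2*Y3 := ⟨_, rfl⟩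
  have a1 := congrArg Complex.re e1
  have a2 := congrArg Complex.im e1
  have a3 := congrArg Complex.re e2
  have a4 := congrArg Complex.im e2
  simp [-neg_mul] at a1 a2 a3 a4
  have b1 : X1+X2+X3 = -s*E := by rw [hE]; linear_combination a1
  have b2 : Y1+Y2+Y3 = -s*F := by rw [hF]; linear_combination a2
  have b3 : X1*X2+X2*X3+X3*X1 - (Y1*Y2+Y2*Y3+Y3*Y1) = -s := by linear_combination a3
  have b4 : X1*Y2+Y1*X2+X2*Y3+Y2*X3+X3*Y1+Y3*X1 = 0 := by linear_combination a4
  have hEF : E^2+F^2 = 1 := by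
    have : E^2+F^2 = (X1^2+Y1^2)*(X2^2+Y2^2)*(X3^2+Y3^2) := by rw [hE, hF]; ring
    rw [this, c1, c2, c3]; ring
  have b5 : X1*X2+X2*X3+X3*X1 = (s-3)*(s+1)/4 := by
    linear_combination (h12+h23+h31)/2 + (1+s)/2*b3 + 3/4*hD'
  have b6 : Y1*Y2+Y2*Y3+Y3*Y1 = (s+3)*(s-1)/4 := by
    linear_combination b5 - b3
  have q1 : X2*X3-Y2*Y3 = E*X1+F*Y1 := by
    rw [hE, hF]; linear_combination (-(X2*X3-Y2*Y3))*c1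
  have q2 : X3*X1-Y3*Y1 = E*X2+F*Y2 := by
    rw [hE, hF]; linear_combination (-(X3*X1-Y3*Y1))*c2
  have q3 : X1*X2-Y1*Y2 = E*X3+F*Y3 := by
    rw [hE, hF]; linear_combination (-(X1*X2-Y1*Y2))*c3
  have t1 : X1^2+X2^2+X3^2 = s^2*E^2-(s-3)*(s+1)/2 := by
    linear_combination (X1+X2+X3 - s*E)*b1 - 2*b5
  have t2 : X1*Y1+X2*Y2+X3*Y3 = s^2*E*F := by
    linear_combination (Y1+Y2+Y3)*b1 - s*E*b2 - b4
  -- the product X1 X2 X3 - 3 terms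
  have x1 : X1*X2*X3 = E*(1+s)^2/4 := by
    have h : X1*(X2*X3-Y2*Y3)+X2*(X3*X1-Y3*Y1)+X3*(X1*X2-Y1*Y2) = E*(s^2+2*s+3)/2 := by
      rw [q1, q2, q3]
      linear_combination E*t1 + F*t2 + E*s^2*hEF
    linear_combination (h + hE)/2
  have p3 : X1^3+X2^3+X3^3 = (X1+X2+X3)^3 - 3*(X1+X2+X3)*(X1*X2+X2*X3+X3*X1) + 3*(X1*X2*X3) := by
    ring
  have yyx : X1*Y1^2+X2*Y2^2+X3*Y3^2 = (-s*E - (-s^3*(E^3-3*E*F^2)+(3-3*s^2)*E))/4 := by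
    rw [b1, b5, x1] at p3
    linear_combination b1 - p3 + X1*c1+X2*c2+X3*c3 + 3/4*s^3*E*hEF
  have y1 : Y1*Y2*Y3 = -(F*(1-s)^2/4) := by
    have h : Y1*(X2*X3-Y2*Y3)+Y2*(X3*X1-Y3*Y1)+Y3*(X1*X2-Y1*Y2) = F*(s^2-2*s+3)/2 := by
      rw [q1, q2, q3]
      linear_combination E*t2 + F*(c1+c2+c3) - F*t1
    linear_combination -(h + hF)/2
  have p3y : Y1^3+Y2^3+Y3^3 = (Y1+Y2+Y3)^3 - 3*(Y1+Y2+Y3)*(Y1*Y2+Y2*Y3+Y3*Y1) + 3*(Y1*Y2*Y3) := by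
    ring
  have xxy : X1^2*Y1+X2^2*Y2+X3^2*Y3 = (-s^3*(3*E^2*F-F^3)+(3-3*s^2)*F - s*F)/4 := by
    rw [b2, b6, y1] at p3y
    linear_combination b2 - p3y + Y1*c1+Y2*c2+Y3*c3 + 3/4*s^3*F*hEF
  exact ⟨E, F, hEF, hD', b1, b2, t1, t2, xxy, yyx, x1, b5, q1, q2, q3⟩

/-- The rational sums over the orbit, in closed form. -/
lemma fi_core (X1 Y1 X2 Y2 X3 Y3 s D a b c κ E F : ℝ)
    (hp : a^2 = (3-s)*(1+s)*κ) (hq : b^2 = (1-s)*(3+s)*κ) (hc : c^2 = 4*s*κ)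
    (hEF : E^2+F^2 = 1) (hD : 2*D = s^2-1)
    (c1 : X1^2+Y1^2 = 1) (c2 : X2^2+Y2^2 = 1) (c3 : X3^2+Y3^2 = 1)
    (h12 : X1*X2+Y1*Y2 - s*(X1*X2-Y1*Y2) = D)
    (h23 : X2*X3+Y2*Y3 - s*(X2*X3-Y2*Y3) = D)
    (h31 : X3*X1+Y3*Y1 - s*(X3*X1-Y3*Y1) = D)
    (b1 : X1+X2+X3 = -s*E) (b2 : Y1+Y2+Y3 = -s*F)
    (t1 : X1^2+X2^2+X3^2 = s^2*E^2-(s-3)*(s+1)/2)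
    (t2 : X1*Y1+X2*Y2+X3*Y3 = s^2*E*F)
    (xxy : X1^2*Y1+X2^2*Y2+X3^2*Y3 = (-s^3*(3*E^2*F-F^3)+(3-3*s^2)*F - s*F)/4)
    (yyx : X1*Y1^2+X2*Y2^2+X3*Y3^2 = (-s*E - (-s^3*(E^3-3*E*F^2)+(3-3*s^2)*E))/4)
    (x1 : X1*X2*X3 = E*(1+s)^2/4)
    (b5 : X1*X2+X2*X3+X3*X1 = (s-3)*(s+1)/4)
    (q1 : X2*X3-Y2*Y3 = E*X1+F*Y1) (q2 : X3*X1-Y3*Y1 = E*X2+F*Y2)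
    (q3 : X1*X2-Y1*Y2 = E*X3+F*Y3)
    (w1 w2 w3 r1 r2 r3 : ℝ)
    (hw1 : w1 = 1 - (X2*X3+Y2*Y3)) (hw2 : w2 = 1 - (X3*X1+Y3*Y1)) (hw3 : w3 = 1 - (X1*X2+Y1*Y2))
    (hr1 : r1 = a+c*X1) (hr2 : r2 = a+c*X2) (hr3 : r3 = a+c*X3) :
    w1*r1+w2*r2+w3*r3 = (3+s)/2*(a*(3-s)-2*c*s*E) ∧
    r1*r2*r3 = κ*(1-s^2)*(a*(3-s)-2*c*s*E) ∧
    c*(1+s)*(w1*(a*X1+c)*(r2*r3)+w2*(a*X2+c)*(r3*r1)+w3*(a*X3+c)*(r1*r2))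
      = (r1*r2*r3)*(s*(3+s)*(a-c*(1+s)*E/2)) ∧
    2*a*(w1*Y1*(r2*r3)+w2*Y2*(r3*r1)+w3*Y3*(r1*r2)) = -s*(3-s)*F*(r1*r2*r3) := by
  have ss : X1^2+X2^2+X3^2+Y1^2+Y2^2+Y3^2 = 3 := by linear_combination c1+c2+c3
  have v1 : w1 = (3-s^2)/2 - s*(E*X1+F*Y1) := by
    rw [hw1]; linear_combination -h23 - hD/2 - s*q1
  have v2 : w2 = (3-s^2)/2 - s*(E*X2+F*Y2) := by
    rw [hw2]; linear_combination -h31 - hD/2 - s*q2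
  have v3 : w3 = (3-s^2)/2 - s*(E*X3+F*Y3) := by
    rw [hw3]; linear_combination -h12 - hD/2 - s*q3
  obtain ⟨β, hβ⟩ : ∃ β, β = a^2 - a*c*s*E + c^2*(s^2-1)/4 := ⟨_, rfl⟩
  obtain ⟨γ, hγ⟩ : ∃ γ, γ = c^2*(1+s)/2 := ⟨_, rfl⟩
  have rr1 : r2*r3 = β - a*c*X1 + γ*(E*X1+F*Y1) := by
    rw [hr2, hr3, hβ, hγ]
    linear_combination a*c*b1 + c^2/2*(h23 + hD/2 + (1+s)*q1)
  have rr2 : r3*r1 = β - a*c*X2 + γ*(E*X2+F*Y2) := by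
    rw [hr3, hr1, hβ, hγ]
    linear_combination a*c*b1 + c^2/2*(h31 + hD/2 + (1+s)*q2)
  have rr3 : r1*r2 = β - a*c*X3 + γ*(E*X3+F*Y3) := by
    rw [hr1, hr2, hβ, hγ]
    linear_combination a*c*b1 + c^2/2*(h12 + hD/2 + (1+s)*q3)
  have hβ' : β = κ*(1+s)*(s^2-2*s+3) - a*c*s*E := by
    rw [hβ]; linear_combination hp + (s^2-1)/4*hc
  have hγ' : γ = 2*s*κ*(1+s) := by rw [hγ]; linear_combination (1+s)/2*hc
  clear hβ hγ
  have sG : (E*X1+F*Y1)+(E*X2+F*Y2)+(E*X3+F*Y3) = -s := by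
    linear_combination E*b1+F*b2 - s*hEF
  have sW : w1+w2+w3 = (9-s^2)/2 := by
    rw [v1,v2,v3]; linear_combination -s*sG
  have ty : Y1^2+Y2^2+Y3^2 = s^2*F^2-(s+3)*(s-1)/2 := by
    linear_combination ss - t1 - s^2*hEF
  have sGX : (E*X1+F*Y1)*X1+(E*X2+F*Y2)*X2+(E*X3+F*Y3)*X3 = E*(s^2+2*s+3)/2 := by
    linear_combination E*t1+F*t2 + s^2*E*hEF
  have sGY : (E*X1+F*Y1)*Y1+(E*X2+F*Y2)*Y2+(E*X3+F*Y3)*Y3 = F*(s^2-2*s+3)/2 := by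
    linear_combination E*t2+F*ty + s^2*F*hEF
  have sGG : (E*X1+F*Y1)^2+(E*X2+F*Y2)^2+(E*X3+F*Y3)^2 = (3+s^2+2*s*(2*E^2-1))/2 := by
    linear_combination E*sGX + F*sGY + (s^2-2*s+3)/2*hEF
  have yyy : Y1^3+Y2^3+Y3^3 = -s*F - (-s^3*(3*E^2*F-F^3)+(3-3*s^2)*F - s*F)/4 := by
    linear_combination b2 - xxy + Y1*c1+Y2*c2+Y3*c3
  have sGXY : (E*X1+F*Y1)*(X1*Y1)+(E*X2+F*Y2)*(X2*Y2)+(E*X3+F*Y3)*(X3*Y3)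
      = -(s^3+s)*E*F/2 := by
    linear_combination E*xxy+F*yyx - s^3*E*F/2*hEF
  have sGGY : (E*X1+F*Y1)^2*Y1+(E*X2+F*Y2)^2*Y2+(E*X3+F*Y3)^2*Y3
      = E*(-(s^3+s)*E*F/2) + E*F*(-s*E - (-s^3*(E^3-3*E*F^2)+(3-3*s^2)*E))/4
        + F^2*(-s*F - (-s^3*(3*E^2*F-F^3)+(3-3*s^2)*F - s*F)/4) := by
    linear_combination E*sGXY + E*F*yyx + F^2*yyy
  have hQ : r1*r2*r3 = κ*(1-s^2)*(a*(3-s)-2*c*s*E) := by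
    have : r1*r2*r3 = a^3 + a^2*c*(-s*E) + a*c^2*((s-3)*(s+1)/4) + c^3*(E*(1+s)^2/4) := by
      rw [hr1,hr2,hr3]
      linear_combination a^2*c*b1 + a*c^2*b5 + c^3*x1
    rw [this]
    linear_combination (a - c*s*E)*hp + (a*(s-3)*(s+1)/4 + c*E*(1+s)^2/4)*hc
  have N1 : w1*(r2*r3)+w2*(r3*r1)+w3*(r1*r2) = (3-s)^2*(3-s^2)*κ*(1+s)/2
      + a*c*s*E*(s+3)*(s-1)/2 - 4*s^3*κ*(1+s)*E^2 := by
    have : w1*(r2*r3)+w2*(r3*r1)+w3*(r1*r2) = 3*((3-s^2)/2)*β - (3-s^2)/2*a*c*(-s*E)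
        + ((3-s^2)/2*γ - s*β)*(-s) + s*a*c*(E*(s^2+2*s+3)/2)
        - s*γ*((3+s^2+2*s*(2*E^2-1))/2) := by
      rw [rr1,rr2,rr3,v1,v2,v3]
      linear_combination -(3-s^2)/2*a*c*b1 + ((3-s^2)/2*γ - s*β)*sG + s*a*c*sGX - s*γ*sGG
    rw [this, hβ', hγ']; ring
  have N2 : w1*Y1*(r2*r3)+w2*Y2*(r3*r1)+w3*Y3*(r1*r2) =
      -(κ*s*(1-s^2)*(3-s)^2*F/2) + s^2*(1-s)*a*c*E*F := by
    have : w1*Y1*(r2*r3)+w2*Y2*(r3*r1)+w3*Y3*(r1*r2) = (3-s^2)/2*β*(-s*F)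
        - (3-s^2)/2*a*c*(s^2*E*F)
        + ((3-s^2)/2*γ - s*β)*(F*(s^2-2*s+3)/2) + s*a*c*(-(s^3+s)*E*F/2)
        - s*γ*(E*(-(s^3+s)*E*F/2) + E*F*(-s*E - (-s^3*(E^3-3*E*F^2)+(3-3*s^2)*E))/4
        + F^2*(-s*F - (-s^3*(3*E^2*F-F^3)+(3-3*s^2)*F - s*F)/4)) := by
      rw [rr1,rr2,rr3,v1,v2,v3]
      linear_combination (3-s^2)/2*β*b2 -(3-s^2)/2*a*c*t2 + ((3-s^2)/2*γ - s*β)*sGY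
        + s*a*c*sGXY - s*γ*sGGY
    have F2 : F^2 = 1 - E^2 := by linear_combination hEF
    have F3 : F^3 = F*(1-E^2) := by linear_combination F*hEF
    rw [this, hβ', hγ', F3, F2]; ring
  refine ⟨?_, hQ, ?_, ?_⟩
  · rw [v1,v2,v3,hr1,hr2,hr3]
    linear_combination (3-s^2)/2*c*b1 - s*a*sG - s*c*sGX
  · have e : c*(w1*(a*X1+c)*(r2*r3)+w2*(a*X2+c)*(r3*r1)+w3*(a*X3+c)*(r1*r2))
        = a*(r1*r2*r3)*(w1+w2+w3) - b^2*(w1*(r2*r3)+w2*(r3*r1)+w3*(r1*r2)) := by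
      have k : c^2 = a^2-b^2 := by rw [hp,hq,hc]; ring
      have k1 : c*(a*X1+c) = a*r1-b^2 := by rw [hr1]; linear_combination k
      have k2 : c*(a*X2+c) = a*r2-b^2 := by rw [hr2]; linear_combination k
      have k3 : c*(a*X3+c) = a*r3-b^2 := by rw [hr3]; linear_combination k
      linear_combination w1*(r2*r3)*k1 + w2*(r3*r1)*k2 + w3*(r1*r2)*k3
    have e' : a*(1+s)*(3-s)/2*(a*(3-s)-2*c*s*E) - ((3-s)^2*(3-s^2)*κ*(1+s)/2
      + a*c*s*E*(s+3)*(s-1)/2 - 4*s^3*κ*(1+s)*E^2)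
      = (a*(3-s)-2*c*s*E)*s*(a-c*(1+s)*E/2) := by
      linear_combination ((1+s)*(3-s)^2/2 - s*(3-s))*hp - s^2*(1+s)*E^2*hc
    rw [sW, N1, hQ, hq] at e
    rw [hQ]
    linear_combination (1+s)*e + (1+s)*(1-s)*(3+s)*κ*e'
  · rw [N2, hQ]
    linear_combination 2*s^2*(1-s)*c*E*F*hp

/-- The final circle identity. -/
lemma fi_circle (s a b c κ E F V1 V2 W : ℝ) (hs0 : 0 < s) (hs1 : s < 1) (hκ : 0 < κ)
    (ha : 0 < a) (hcp : 0 < c)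
    (hp : a^2 = (3-s)*(1+s)*κ) (hq : b^2 = (1-s)*(3+s)*κ) (hc : c^2 = 4*s*κ)
    (hEF : E^2+F^2 = 1)
    (hW : W = (3+s)/2*(a*(3-s)-2*c*s*E))
    (hV1 : c*(1+s)*V1 = s*(3+s)*(a-c*(1+s)*E/2))
    (hV2 : 2*a*V2 = -b*s*(3-s)*F) :
    (V1 - 3*c/(2*κ*(3+s)^2)*W)^2 + V2^2 = (s*(3-s)/(a*(3+s)^2)*W)^2 := by
  have n1 : (1+s) ≠ 0 := by positivity
  have n3 : (3+s) ≠ 0 := by positivity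
  have n3' : (3-s) ≠ 0 := by linarith
  have e1 : 3*c/(2*κ*(3+s)^2)*W = 3*c*(a*(3-s)-2*c*s*E)/(4*κ*(3+s)) := by
    rw [hW]; field_simp; ring
  have hcs : c^2/κ = 4*s := by rw [hc]; field_simp
  have e2 : c*(1+s)*(2*(3+s))*(V1 - 3*c/(2*κ*(3+s)^2)*W) = s*(8*a*s^2 - (3-s)^2*(c*(1+s)*E)) := by
    rw [e1]
    have : c*(1+s)*(2*(3+s))*(V1 - 3*c*(a*(3-s)-2*c*s*E)/(4*κ*(3+s)))
      = 2*(3+s)*(c*(1+s)*V1) - 3*(1+s)/2*(c^2/κ)*(a*(3-s)-2*c*s*E) := by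
      field_simp; ring
    rw [this, hV1, hcs]; ring
  have e3 : 2*(3+s)*a*(s*(3-s)/(a*(3+s)^2)*W) = s*(3-s)*(a*(3-s)-2*c*s*E) := by
    rw [hW]; field_simp
  generalize V1 - 3*c/(2*κ*(3+s)^2)*W = x at *
  generalize s*(3-s)/(a*(3+s)^2)*W = y at *
  have hn : (2*(3+s)*c*(1+s)*a)^2 ≠ 0 := by positivity
  apply mul_left_cancel₀ hn
  have f1 : (2*(3+s)*c*(1+s)*a)^2*x^2 = a^2*(s*(8*a*s^2 - (3-s)^2*(c*(1+s)*E)))^2 := by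
    rw [← e2]; ring
  have f2 : (2*(3+s)*c*(1+s)*a)^2*V2^2 = ((3+s)*c*(1+s))^2*(-b*s*(3-s)*F)^2 := by
    rw [← hV2]; ring
  have f3 : (2*(3+s)*c*(1+s)*a)^2*y^2 = (c*(1+s))^2*(s*(3-s)*(a*(3-s)-2*c*s*E))^2 := by
    rw [← e3]; ring
  rw [mul_add, f1, f2, f3]
  have F2 : F^2 = 1 - E^2 := by linear_combination hEF
  have g2 : ((3+s)*c*(1+s))^2*(-b*s*(3-s)*F)^2
     = (3+s)^2*(1+s)^2*(4*s*κ)*((1-s)*(3+s)*κ)*s^2*(3-s)^2*(1-E^2) := by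
    rw [← hc, ← hq, ← F2]; ring
  have g1 : a^2*(s*(8*a*s^2 - (3-s)^2*(c*(1+s)*E)))^2
     = ((3-s)*(1+s)*κ)*s^2*(64*((3-s)*(1+s)*κ)*s^4 - 16*(a*c)*s^2*(3-s)^2*(1+s)*E
        + (3-s)^4*(4*s*κ)*(1+s)^2*E^2) := by
    rw [← hp, ← hc]; ring
  have g3 : (c*(1+s))^2*(s*(3-s)*(a*(3-s)-2*c*s*E))^2
     = (4*s*κ)*(1+s)^2*s^2*(3-s)^2*(((3-s)*(1+s)*κ)*(3-s)^2 - 4*(a*c)*(3-s)*s*E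
        + 4*(4*s*κ)*s^2*E^2) := by
    rw [← hp, ← hc]; ring
  rw [g1, g2, g3]; ring

/-- Distance between two inverses. -/
lemma fi_inv_dist (u1 u2 v1 v2 r t d ρ : ℝ) (hr : 0 < r) (ht : 0 < t) (hd : 0 ≤ d)
    (hu : u1^2+u2^2 = r^2) (hv : v1^2+v2^2 = t^2) (h : (u1-v1)^2+(u2-v2)^2 = d^2) :
    Real.sqrt ((ρ^2/r^2*u1 - ρ^2/t^2*v1)^2 + (ρ^2/r^2*u2 - ρ^2/t^2*v2)^2) = ρ^2*d/(r*t) := by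
  have e : (ρ^2/r^2*u1 - ρ^2/t^2*v1)^2 + (ρ^2/r^2*u2 - ρ^2/t^2*v2)^2 = (ρ^2*d/(r*t))^2 := by
    have : (ρ^2*d/(r*t))^2 = ρ^4*((u1-v1)^2+(u2-v2)^2)/(r^2*t^2) := by rw [h]; field_simp
    rw [this]
    have l1 : (ρ^2/r^2*u1 - ρ^2/t^2*v1)^2 + (ρ^2/r^2*u2 - ρ^2/t^2*v2)^2
      = ρ^4*((u1^2+u2^2)/r^4 + (v1^2+v2^2)/t^4 - 2*(u1*v1+u2*v2)/(r^2*t^2)) := by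
      field_simp; ring
    have l2 : (u1-v1)^2+(u2-v2)^2 = r^2+t^2-2*(u1*v1+u2*v2) := by rw [← hu, ← hv]; ring
    rw [l1, l2, hu, hv]; field_simp; ring
  rw [e, Real.sqrt_sq (by positivity)]

lemma fi_pos (X1 Y1 X2 Y2 : ℝ) (c1 : X1^2+Y1^2 = 1) (c2 : X2^2+Y2^2 = 1)
    (n : ¬ (X1 = X2 ∧ Y1 = Y2)) : 0 < 1 - (X1*X2+Y1*Y2) := by
  by_contra h
  have h0 : (X1-X2)^2+(Y1-Y2)^2 ≤ 0 := by nlinarith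
  apply n
  constructor <;> nlinarith [sq_nonneg (X1-X2), sq_nonneg (Y1-Y2)]

lemma fi_joach (a b J X1 Y1 X2 Y2 : ℝ) (hJ : 0 < J) (c1 : X1^2+Y1^2 = 1) (c2 : X2^2+Y2^2 = 1)
    (n : ¬ (X1 = X2 ∧ Y1 = Y2))
    (d : (a*X1-a*X2)^2+(b*Y1-b*Y2)^2 = ((1-(X1*X2+Y1*Y2))/J)^2) :
    X1*X2+Y1*Y2 - J^2*(a^2-b^2)*(X1*X2-Y1*Y2) = 1 - J^2*(a^2+b^2) := by
  have hk := fi_pos X1 Y1 X2 Y2 c1 c2 n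
  have x : (X1-X2)^2 = (1-(X1*X2+Y1*Y2))*(1-(X1*X2-Y1*Y2)) := by
    linear_combination Y2^2*c1+(1-X1^2)*c2
  have y : (Y1-Y2)^2 = (1-(X1*X2+Y1*Y2))*(1+(X1*X2-Y1*Y2)) := by
    linear_combination X2^2*c1+(1-Y1^2)*c2
  have d' : J^2*(a^2*(X1-X2)^2+b^2*(Y1-Y2)^2) = (1-(X1*X2+Y1*Y2))^2 := by
    have : a^2*(X1-X2)^2+b^2*(Y1-Y2)^2 = ((1-(X1*X2+Y1*Y2))/J)^2 := by rw [← d]; ring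
    rw [this]; field_simp
  rw [x, y] at d'
  apply mul_left_cancel₀ hk.ne'
  linear_combination d'

set_option maxHeartbeats 2000000 in
lemma fi_main (a b ρ J X1 Y1 X2 Y2 X3 Y3 : ℝ) (hab : a > b) (hb : b > 0) (hρ : ρ > 0)
    (hJ : 0 < J)
    (c1 : X1^2+Y1^2 = 1) (c2 : X2^2+Y2^2 = 1) (c3 : X3^2+Y3^2 = 1)
    (n12 : ¬ (X1 = X2 ∧ Y1 = Y2)) (n23 : ¬ (X2 = X3 ∧ Y2 = Y3)) (n31 : ¬ (X3 = X1 ∧ Y3 = Y1))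
    (d12 : (a*X1-a*X2)^2+(b*Y1-b*Y2)^2 = ((1-(X1*X2+Y1*Y2))/J)^2)
    (d23 : (a*X2-a*X3)^2+(b*Y2-b*Y3)^2 = ((1-(X2*X3+Y2*Y3))/J)^2)
    (d31 : (a*X3-a*X1)^2+(b*Y3-b*Y1)^2 = ((1-(X3*X1+Y3*Y1))/J)^2)
    (c δ : ℝ) (hcd : c = Real.sqrt (a ^ 2 - b ^ 2))
    (hδ : δ = Real.sqrt (a ^ 4 - a ^ 2 * b ^ 2 + b ^ 4)) :
    dst (incenter (inva ρ (-c, 0) (a*X1, b*Y1)) (inva ρ (-c, 0) (a*X2, b*Y2))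
        (inva ρ (-c, 0) (a*X3, b*Y3)))
      (c * (-1 + ρ ^ 2 * (-2 * a ^ 2 + b ^ 2 + 2 * δ) / (2 * b ^ 4)), 0) =
      ρ ^ 2 * (-2 * δ ^ 2 + b ^ 4 + (2 * a ^ 2 - b ^ 2) * δ) / (2 * a * b ^ 4) := by
  have ha : 0 < a := hb.trans hab
  have hpq : 0 < a^2-b^2 := by nlinarith
  have hc2 : c^2 = a^2-b^2 := by rw [hcd, Real.sq_sqrt hpq.le]
  have hc0 : 0 < c := by rw [hcd]; exact Real.sqrt_pos.2 hpq
  have hca : c < a := by nlinarith [sq_pos_of_pos hb]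
  have h12 := fi_joach a b J X1 Y1 X2 Y2 hJ c1 c2 n12 d12
  have h23 := fi_joach a b J X2 Y2 X3 Y3 hJ c2 c3 n23 d23
  have h31 := fi_joach a b J X3 Y3 X1 Y1 hJ c3 c1 n31 d31
  obtain ⟨s, hs⟩ : ∃ s, s = J^2*(a^2-b^2) := ⟨_, rfl⟩
  obtain ⟨D, hDd⟩ : ∃ D, D = 1 - J^2*(a^2+b^2) := ⟨_, rfl⟩
  rw [← hs, ← hDd] at h12 h23 h31
  obtain ⟨E, F, hEF, hD, b1, b2, t1, t2, xxy, yyx, x1, b5, q1, q2, q3⟩ :=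
    fi_sums X1 Y1 X2 Y2 X3 Y3 s D c1 c2 c3 n12 n23 n31 h12 h23 h31
  have hs0 : 0 < s := by rw [hs]; positivity
  obtain ⟨κ, hκd⟩ : ∃ κ, κ = 1/(4*J^2) := ⟨_, rfl⟩
  have hκ : 0 < κ := by rw [hκd]; positivity
  have hκJ : 4*J^2*κ = 1 := by rw [hκd]; field_simp
  have hp : a^2 = (3-s)*(1+s)*κ := by
    have : 4*J^2*a^2 = (3-s)*(1+s) := by linear_combination -2*hs + 2*hDd - hD
    rw [← this]; linear_combination -a^2*hκJ
  have hq : b^2 = (1-s)*(3+s)*κ := by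
    have : 4*J^2*b^2 = (1-s)*(3+s) := by linear_combination 2*hs + 2*hDd - hD
    rw [← this]; linear_combination -b^2*hκJ
  have hc : c^2 = 4*s*κ := by rw [hc2, hp, hq]; ring
  have hs1 : s < 1 := by
    by_contra h
    have : (1-s)*(3+s)*κ ≤ 0 := by
      apply mul_nonpos_of_nonpos_of_nonneg _ hκ.le
      apply mul_nonpos_of_nonpos_of_nonneg <;> linarith
    have hb2 : 0 < b^2 := by positivity
    linarith
  have hδ' : δ = κ*(3+s^2) := by
    have e4 : a^4 = ((3-s)*(1+s)*κ)^2 := by rw [← hp]; ring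
    have e4' : b^4 = ((1-s)*(3+s)*κ)^2 := by rw [← hq]; ring
    have e : a ^ 4 - a ^ 2 * b ^ 2 + b ^ 4 = (κ*(3+s^2))^2 := by
      rw [e4, e4', hp, hq]; ring
    rw [hδ, e, Real.sqrt_sq (by positivity)]
  have hb4 : b^4 = ((1-s)*(3+s)*κ)^2 := by rw [← hq]; ring
  have n1s : 1 - s ≠ 0 := by linarith
  have n3s : 3 + s ≠ 0 := by positivity
  have hh : (-2 * a ^ 2 + b ^ 2 + 2 * δ) / (2 * b ^ 4) = 3/(2*κ*(3+s)^2) := by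
    rw [hb4, hp, hq, hδ']; field_simp; ring
  have hR : (-2 * δ ^ 2 + b ^ 4 + (2 * a ^ 2 - b ^ 2) * δ) / (2 * a * b ^ 4)
      = s*(3-s)/(a*(3+s)^2) := by
    rw [hb4, hp, hq, hδ']; field_simp; ring
  -- focal radii
  have hX : ∀ X Y : ℝ, X^2+Y^2 = 1 → 0 < a + c*X := by
    intro X Y h
    have hX2 : -1 ≤ X := by
      have : X^2 ≤ 1 := by linarith [sq_nonneg Y]
      exact (abs_le.1 (abs_le_one_iff_mul_self_le_one.2 (by linarith [sq X]))).1
    have : 0 ≤ c*(X+1) := mul_nonneg hc0.le (by linarith)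
    linarith
  have hrad : ∀ X Y : ℝ, X^2+Y^2 = 1 → (a*X+c)^2+(b*Y)^2 = (a+c*X)^2 := by
    intro X Y h
    linear_combination b^2*h + (1-X^2)*hc2
  obtain ⟨w1, hw1⟩ : ∃ w, w = 1 - (X2*X3+Y2*Y3) := ⟨_, rfl⟩
  obtain ⟨w2, hw2⟩ : ∃ w, w = 1 - (X3*X1+Y3*Y1) := ⟨_, rfl⟩
  obtain ⟨w3, hw3⟩ : ∃ w, w = 1 - (X1*X2+Y1*Y2) := ⟨_, rfl⟩
  obtain ⟨r1, hr1⟩ : ∃ r, r = a+c*X1 := ⟨_, rfl⟩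
  obtain ⟨r2, hr2⟩ : ∃ r, r = a+c*X2 := ⟨_, rfl⟩
  obtain ⟨r3, hr3⟩ : ∃ r, r = a+c*X3 := ⟨_, rfl⟩
  obtain ⟨kW, -, kV1, kV2⟩ := fi_core X1 Y1 X2 Y2 X3 Y3 s D a b c κ E F hp hq hc hEF hD c1 c2 c3
    h12 h23 h31 b1 b2 t1 t2 xxy yyx x1 b5 q1 q2 q3 w1 w2 w3 r1 r2 r3 hw1 hw2 hw3 hr1 hr2 hr3
  have pw1 : 0 < w1 := hw1 ▸ fi_pos _ _ _ _ c2 c3 n23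
  have pw2 : 0 < w2 := hw2 ▸ fi_pos _ _ _ _ c3 c1 n31
  have pw3 : 0 < w3 := hw3 ▸ fi_pos _ _ _ _ c1 c2 n12
  have pr1 : 0 < r1 := hr1 ▸ hX _ _ c1
  have pr2 : 0 < r2 := hr2 ▸ hX _ _ c2
  have pr3 : 0 < r3 := hr3 ▸ hX _ _ c3
  have u1 := hrad X1 Y1 c1
  have u2 := hrad X2 Y2 c2
  have u3 := hrad X3 Y3 c3
  rw [← hr1] at u1
  rw [← hr2] at u2
  rw [← hr3] at u3
  rw [← hw3] at d12
  rw [← hw1] at d23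
  rw [← hw2] at d31
  have inv_eq : ∀ X Y r : ℝ, (a*X+c)^2+(b*Y)^2 = r^2 →
      inva ρ (-c, 0) (a*X, b*Y) = (-c + ρ^2/r^2*(a*X+c), ρ^2/r^2*(b*Y)) := by
    intro X Y r h
    simp only [inva, sub_neg_eq_add, sub_zero, h]
    ext <;> simp
  rw [inv_eq _ _ _ u1, inv_eq _ _ _ u2, inv_eq _ _ _ u3]
  have side : ∀ X Y r X' Y' r' d : ℝ, (a*X+c)^2+(b*Y)^2 = r^2 → (a*X'+c)^2+(b*Y')^2 = r'^2 →
      0 < r → 0 < r' → 0 < d → (a*X-a*X')^2+(b*Y-b*Y')^2 = d^2 →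
      dst (-c + ρ^2/r^2*(a*X+c), ρ^2/r^2*(b*Y)) (-c + ρ^2/r'^2*(a*X'+c), ρ^2/r'^2*(b*Y'))
        = ρ^2*d/(r*r') := by
    intro X Y r X' Y' r' d h h' hr hr' hd hdd
    rw [← fi_inv_dist _ _ _ _ r r' d ρ hr hr' hd.le h h' (by rw [← hdd]; ring)]
    simp only [dst]
    congr 1; ring
  have s1 := side _ _ _ _ _ _ _ u2 u3 pr2 pr3 (div_pos pw1 hJ) d23
  have s2 := side _ _ _ _ _ _ _ u3 u1 pr3 pr1 (div_pos pw2 hJ) d31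
  have s3 := side _ _ _ _ _ _ _ u1 u2 pr1 pr2 (div_pos pw3 hJ) d12
  obtain ⟨W, hW⟩ : ∃ W, W = w1*r1+w2*r2+w3*r3 := ⟨_, rfl⟩
  have pW : 0 < W := by rw [hW]; positivity
  obtain ⟨V1, hV1⟩ : ∃ V, V = w1*(a*X1+c)/r1+w2*(a*X2+c)/r2+w3*(a*X3+c)/r3 := ⟨_, rfl⟩
  obtain ⟨V2, hV2⟩ : ∃ V, V = w1*(b*Y1)/r1+w2*(b*Y2)/r2+w3*(b*Y3)/r3 := ⟨_, rfl⟩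
  have hI : incenter (-c + ρ^2/r1^2*(a*X1+c), ρ^2/r1^2*(b*Y1))
      (-c + ρ^2/r2^2*(a*X2+c), ρ^2/r2^2*(b*Y2)) (-c + ρ^2/r3^2*(a*X3+c), ρ^2/r3^2*(b*Y3))
      = (-c + ρ^2*(V1/W), ρ^2*(V2/W)) := by
    simp only [incenter, sA, sB, sC, s1, s2, s3, bary]
    have hsum : ρ^2*(w1/J)/(r2*r3) + ρ^2*(w2/J)/(r3*r1) + ρ^2*(w3/J)/(r1*r2)
        = ρ^2*W/(J*(r1*r2*r3)) := by
      rw [hW]; field_simp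
    rw [hsum]
    ext
    · simp only [Prod.smul_mk, Prod.mk_add_mk, smul_eq_mul]
      have : ρ^2*(w1/J)/(r2*r3)*(-c + ρ^2/r1^2*(a*X1+c)) + ρ^2*(w2/J)/(r3*r1)*(-c + ρ^2/r2^2*(a*X2+c))
         + ρ^2*(w3/J)/(r1*r2)*(-c + ρ^2/r3^2*(a*X3+c)) = ρ^2/(J*(r1*r2*r3))*(-c*W + ρ^2*V1) := by
        rw [hW, hV1]; field_simp; ring
      rw [this]; field_simp
    · simp only [Prod.smul_mk, Prod.mk_add_mk, smul_eq_mul]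
      have : ρ^2*(w1/J)/(r2*r3)*(ρ^2/r1^2*(b*Y1)) + ρ^2*(w2/J)/(r3*r1)*(ρ^2/r2^2*(b*Y2))
         + ρ^2*(w3/J)/(r1*r2)*(ρ^2/r3^2*(b*Y3)) = ρ^2/(J*(r1*r2*r3))*(ρ^2*V2) := by
        rw [hV2]; field_simp
      rw [this]; field_simp
  rw [hI]
  have hQ : r1*r2*r3 ≠ 0 := by positivity
  have hV1' : c*(1+s)*V1 = s*(3+s)*(a-c*(1+s)*E/2) := by
    apply mul_left_cancel₀ hQ
    rw [← kV1, hV1]; field_simp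
  have hV2' : 2*a*V2 = -b*s*(3-s)*F := by
    apply mul_left_cancel₀ hQ
    have : r1*r2*r3*(-b*s*(3-s)*F) = b*(-s*(3-s)*F*(r1*r2*r3)) := by ring
    rw [this, ← kV2, hV2]; field_simp
  have key := fi_circle s a b c κ E F V1 V2 W hs0 hs1 hκ ha hc0 hp hq hc hEF (hW.trans kW)
    hV1' hV2'
  have hR0 : 0 ≤ s*(3-s)/(a*(3+s)^2) := by
    have : 0 < 3 - s := by linarith
    positivity
  rw [mul_div_assoc, mul_div_assoc, hR, hh]
  simp only [dst]
  have fin : (-c + ρ^2*(V1/W) - c*(-1+ρ^2*(3/(2*κ*(3+s)^2))))^2 + (ρ^2*(V2/W) - 0)^2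
      = (ρ^2*(s*(3-s)/(a*(3+s)^2)))^2 := by
    have l : (-c + ρ^2*(V1/W) - c*(-1+ρ^2*(3/(2*κ*(3+s)^2))))^2 + (ρ^2*(V2/W) - 0)^2
      = ρ^4/W^2*((V1 - 3*c/(2*κ*(3+s)^2)*W)^2 + V2^2) := by
      field_simp; ring
    rw [l, key]; field_simp
  rw [fin, Real.sqrt_sq (by positivity)]

lemma fi_dst_symm (p q : Pt) : dst p q = dst q p := by
  simp only [dst]; congr 1; ring

lemma fi_dot (a b : ℝ) (v q : Pt) (ha : a ≠ 0) (hb : b ≠ 0) (hv : onEllipse a b v) :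
    dot (udir v q) (nrm a b v)
      = -((1 - (v.1/a*(q.1/a)+v.2/b*(q.2/b))) / dst v q) := by
  have h : v.1 ^ 2 / a ^ 2 + v.2 ^ 2 / b ^ 2 = 1 := hv
  simp only [dot, udir, nrm, Prod.smul_fst, Prod.smul_snd, Prod.fst_sub, Prod.snd_sub, smul_eq_mul]
  rw [← h]; ring

/-- over the 3-periodic billiard family, the incenter X(1) of the
focus-inversive triangle lies on the stated circle. -/
theorem focus_inversive_incenter_circle (a b ρ : ℝ) (hab : a > b) (hb : b > 0)
    (hρ : ρ > 0) (T : Orbit3 a b) :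
    let c : ℝ := Real.sqrt (a ^ 2 - b ^ 2)
    let δ : ℝ := Real.sqrt (a ^ 4 - a ^ 2 * b ^ 2 + b ^ 4)
    let f1 : Pt := (-c, 0)
    let Ctr : Pt := (c * (-1 + ρ ^ 2 * (-2 * a ^ 2 + b ^ 2 + 2 * δ) / (2 * b ^ 4)), 0)
    dst (incenter (inva ρ f1 T.P1) (inva ρ f1 T.P2) (inva ρ f1 T.P3)) Ctr =
      ρ ^ 2 * (-2 * δ ^ 2 + b ^ 4 + (2 * a ^ 2 - b ^ 2) * δ) / (2 * a * b ^ 4) := by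
  intro c δ f1 Ctr
  obtain ⟨P1, P2, P3, h1, h2, h3, n12, n23, n31, e1, e2, e3⟩ := T
  have ha0 : 0 < a := hb.trans hab
  have ha : a ≠ 0 := ha0.ne'
  have hb' : b ≠ 0 := hb.ne'
  have circ : ∀ p : Pt, onEllipse a b p → (p.1/a)^2+(p.2/b)^2 = 1 := by
    intro p hp
    have h : p.1 ^ 2 / a ^ 2 + p.2 ^ 2 / b ^ 2 = 1 := hp
    rw [← h]; ring
  have ne : ∀ p q : Pt, p ≠ q → ¬ (p.1/a = q.1/a ∧ p.2/b = q.2/b) := by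
    rintro p q hn ⟨hx, hy⟩
    apply hn
    ext
    · exact (div_left_inj' ha).1 hx
    · exact (div_left_inj' hb').1 hy
  have coords : ∀ p : Pt, p = (a*(p.1/a), b*(p.2/b)) := by
    intro p; ext <;> simp <;> field_simp
  have dpos : ∀ p q : Pt, p ≠ q → 0 < dst p q := by
    intro p q hn
    apply Real.sqrt_pos.2
    by_contra h
    apply hn
    ext <;> nlinarith [sq_nonneg (p.1-q.1), sq_nonneg (p.2-q.2)]
  have p12 := dpos _ _ n12
  have p23 := dpos _ _ n23
  have p31 := dpos _ _ n31
  have k12 := fi_pos _ _ _ _ (circ _ h1) (circ _ h2) (ne _ _ n12)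
  have k23 := fi_pos _ _ _ _ (circ _ h2) (circ _ h3) (ne _ _ n23)
  have k31 := fi_pos _ _ _ _ (circ _ h3) (circ _ h1) (ne _ _ n31)
  simp only [reflectAt] at e1 e2 e3
  rw [fi_dot a b _ _ ha hb' h1, fi_dot a b _ _ ha hb' h1] at e1
  rw [fi_dot a b _ _ ha hb' h2, fi_dot a b _ _ ha hb' h2] at e2
  rw [fi_dst_symm P1 P3] at e1
  rw [fi_dst_symm P2 P1] at e2
  have f1' := neg_injective e1
  have f2' := neg_injective e2
  obtain ⟨J, hJ⟩ : ∃ J, J = (1 - (P1.1/a*(P2.1/a)+P1.2/b*(P2.2/b))) / dst P1 P2 := ⟨_, rfl⟩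
  have hJ0 : 0 < J := hJ ▸ div_pos k12 p12
  have sq : ∀ p q : Pt, ∀ w : ℝ, 0 < dst p q → J = w / dst p q →
      (a*(p.1/a)-a*(q.1/a))^2+(b*(p.2/b)-b*(q.2/b))^2 = (w/J)^2 := by
    intro p q w hd h
    have hw : w/J = dst p q := by
      rw [div_eq_iff hJ0.ne', h]; field_simp
    rw [hw, dst, Real.sq_sqrt (by positivity), mul_div_cancel₀ _ ha, mul_div_cancel₀ _ ha,
      mul_div_cancel₀ _ hb', mul_div_cancel₀ _ hb']
  have main := fi_main a b ρ J _ _ _ _ _ _ hab hb hρ hJ0 (circ _ h1) (circ _ h2) (circ _ h3)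
    (ne _ _ n12) (ne _ _ n23) (ne _ _ n31)
    (sq P1 P2 _ p12 hJ)
    (sq P2 P3 _ p23 (by rw [hJ, ← f2']; ring))
    (sq P3 P1 _ p31 (by rw [hJ, ← f1']; ring)) c δ rfl rfl
  rw [← coords P1, ← coords P2, ← coords P3] at main
  exact main
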